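/- (Proposition 1.) For natural numbers N ≥ 1 and K ≥ 1, under the uniform probability distribution on the finite set Sym (Fin K) N of multisets of cardinality N over Fin K, the expected value of the number M of distinct categories (the support cardinality of the multiset) equals Σ_{k=1}^{K} k · C(N−1,k−1)·C(K,k) / C(N+K−1,K−1), the expectation and the sum being computed in the real numbers. -/

import Mathlib

open Finset MeasureTheory

theorem Sym.card_filter_mem {α : Type*} [Fintype α] [DecidableEq α] (n : ℕ) (a : α) :
    #{s : Sym α (n + 1) | a ∈ s} = Fintype.card (Sym α n) := by
  rw [← Finset.card_univ,
    ← Finset.card_image_of_injective univ (fun _ _ => (Sym.cons_inj_right a _ _).mp)]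
  congr 1
  ext s
  simp only [mem_filter, mem_univ, true_and, mem_image]
  exact ⟨fun h => ⟨s.erase a h, Sym.cons_erase h⟩, fun ⟨t, ht⟩ => ht ▸ Sym.mem_cons_self a t⟩

theorem Sym.sum_card_toFinset {α : Type*} [Fintype α] [DecidableEq α] (n : ℕ) :
    ∑ s : Sym α (n + 1), #(s : Multiset α).toFinset =
      Fintype.card α * Fintype.card (Sym α n) := by
  have h (s : Sym α (n + 1)) : #(s : Multiset α).toFinset = ∑ a : α, if a ∈ s then 1 else 0 := by
    rw [← Finset.card_filter]
    congr 1
    ext a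
    simp
  simp_rw [h]
  rw [Finset.sum_comm]
  simp_rw [← Finset.card_filter, Sym.card_filter_mem, Finset.sum_const, Finset.card_univ,
    smul_eq_mul]

theorem Nat.sum_range_choose_mul_choose (m n : ℕ) :
    ∑ k ∈ range (m + 1), n.choose k * m.choose k = (n + m).choose m := by
  rw [Nat.add_choose_eq,
    Finset.Nat.sum_antidiagonal_eq_sum_range_succ (fun i j => n.choose i * m.choose j)]
  refine Finset.sum_congr rfl fun k hk => ?_
  rw [Nat.choose_symm (Nat.lt_succ_iff.mp (Finset.mem_range.mp hk))]

theorem Nat.sum_Icc_mul_choose_mul_choose (m n : ℕ) :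
    ∑ k ∈ Finset.Icc 1 (m + 1), k * (n.choose (k - 1) * (m + 1).choose k) =
      (m + 1) * (n + m).choose m := by
  rw [← Nat.sum_range_choose_mul_choose, ← Finset.Ico_add_one_right_eq_Icc,
    Finset.sum_Ico_eq_sum_range, Finset.mul_sum]
  refine Finset.sum_congr rfl fun k _ => ?_
  rw [Nat.add_comm 1 k, Nat.add_sub_cancel]
  linear_combination n.choose k * (Nat.add_one_mul_choose_eq m k).symm

/-- (Proposition 1.) For `N ≥ 1` and `K ≥ 1`, under the uniform probability distribution
on the finite set `Sym (Fin K) N` of multisets of cardinality `N` over `Fin K`, the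
expected number of distinct categories (the support cardinality of the multiset) equals
`Σ_{k=1}^{K} k · C(N−1,k−1)·C(K,k) / C(N+K−1,K−1)`, computed in the real numbers. -/
theorem expected_class_diversity (N K : ℕ) (hN : 1 ≤ N) (hK : 1 ≤ K) :
    letI : MeasurableSpace (Sym (Fin K) N) := ⊤
    haveI : Nonempty (Fin K) := ⟨⟨0, hK⟩⟩
    haveI : Nonempty (Sym (Fin K) N) := ⟨Sym.replicate N ⟨0, hK⟩⟩
    ∫ s, ((s : Multiset (Fin K)).toFinset.card : ℝ)
        ∂(PMF.uniformOfFintype (Sym (Fin K) N)).toMeasure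
      = ∑ k ∈ Finset.Icc 1 K,
          (k : ℝ) * ((N - 1).choose (k - 1) * K.choose k) / (N + K - 1).choose (K - 1) := by
  obtain ⟨n, rfl⟩ := Nat.exists_eq_add_of_le' hN
  obtain ⟨m, rfl⟩ := Nat.exists_eq_add_of_le' hK
  let _ : MeasurableSpace (Sym (Fin (m + 1)) (n + 1)) := ⊤
  have hs : ∑ s : Sym (Fin (m + 1)) (n + 1), ((s : Multiset (Fin (m + 1))).toFinset.card : ℝ) =
      ∑ k ∈ Finset.Icc 1 (m + 1),
        (k : ℝ) * ((n + 1 - 1).choose (k - 1) * (m + 1).choose k) := by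
    have h := (Sym.sum_card_toFinset (α := Fin (m + 1)) n).trans <|
      show _ = ∑ k ∈ Finset.Icc 1 (m + 1), k * (n.choose (k - 1) * (m + 1).choose k) by
        rw [Nat.sum_Icc_mul_choose_mul_choose, Sym.card_sym_eq_choose, Fintype.card_fin,
          show m + 1 + n - 1 = n + m by lia, Nat.choose_symm_add]
    exact_mod_cast h
  have hc : Fintype.card (Sym (Fin (m + 1)) (n + 1)) =
      (n + 1 + (m + 1) - 1).choose (m + 1 - 1) := by
    rw [Sym.card_sym_eq_choose, Fintype.card_fin, show m + 1 + (n + 1) - 1 = n + 1 + m by lia,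
      Nat.choose_symm_add]
    rfl
  rw [PMF.integral_eq_sum]
  simp only [PMF.uniformOfFintype_apply, ENNReal.toReal_inv, ENNReal.toReal_natCast, smul_eq_mul]
  rw [← Finset.mul_sum, ← Finset.sum_div, hs, hc, div_eq_inv_mul]
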